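/- Let α be a minimal action of a countable group Γ by homeomorphisms on a nonempty compact Hausdorff 0-dimensional space X. Then α has dynamical comparison if and only if T(α) is almost unperforated, i.e., for all a,b ∈ T(α) and all n ∈ ℕ, (n+1)a ≤ nb implies a ≤ b. -/

import Mathlib

open MeasureTheory Set
open scoped ENNReal

/-! Preliminary definitions: the clopen type semigroup of an action of a group `Γ`
by homeomorphisms on a topological space `X`, invariant measures, dynamical comparison,
topological full groups, and the topology on spaces of actions. -/

/-- The group of self-homeomorphisms of `X`, with `(g * h) x = g (h x)`. -/
instance homeoGroup (X : Type*) [TopologicalSpace X] : Group (X ≃ₜ X) where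
  mul g h := h.trans g
  one := Homeomorph.refl X
  inv := Homeomorph.symm
  mul_assoc a b c := Homeomorph.ext fun _ => rfl
  one_mul a := Homeomorph.ext fun _ => rfl
  mul_one a := Homeomorph.ext fun _ => rfl
  inv_mul_cancel a := Homeomorph.ext fun x => a.symm_apply_apply x

/-- The Cantor space `{0,1}^ℕ`. -/
abbrev Cantor : Type := ℕ → Bool

section Defs

variable {Γ : Type*} [Group Γ] {X : Type*} [TopologicalSpace X]

/-- A left-invariant finitely additive probability measure on (the power set of) `Γ`,
with values in `[0,1]`. `Γ` is amenable iff such a measure exists. -/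
def IsInvFapm {Γ : Type*} [Group Γ] (m : Set Γ → ℝ) : Prop :=
  (∀ E : Set Γ, 0 ≤ m E) ∧ (∀ E : Set Γ, m E ≤ 1) ∧ m Set.univ = 1 ∧
  (∀ E F : Set Γ, Disjoint E F → m (E ∪ F) = m E + m F) ∧
  (∀ (γ : Γ) (E : Set Γ), m ((γ * ·) '' E) = m E)

/-- The action of `γ ∈ Γ` on continuous `ℕ`-valued functions: `(γ · f)(x) = f(γ⁻¹ · x)`. -/
def actC (α : Γ →* X ≃ₜ X) (γ : Γ) (f : C(X, ℕ)) : C(X, ℕ) :=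
  f.comp (α γ⁻¹)

/-- The equidecomposability relation `∼` on `C(X, ℕ)`: `f ∼ g` iff `f = h₁ + ⋯ + hₙ`
and `g = γ₁·h₁ + ⋯ + γₙ·hₙ` for some `hᵢ ∈ C(X,ℕ)`, `γᵢ ∈ Γ`. -/
def TypeRel (α : Γ →* X ≃ₜ X) (f g : C(X, ℕ)) : Prop :=
  ∃ (n : ℕ) (h : Fin n → C(X, ℕ)) (γ : Fin n → Γ),
    f = ∑ i, h i ∧ g = ∑ i, actC α (γ i) (h i)

/-- The additive congruence on `C(X, ℕ)` generated by `∼` (since `∼` is itself an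
additive congruence, this is just `∼`). -/
def typeCon (α : Γ →* X ≃ₜ X) : AddCon C(X, ℕ) := addConGen (TypeRel α)

/-- The clopen type semigroup `T(α) = C(X,ℕ)/∼`. -/
abbrev TypeSemigroup (α : Γ →* X ≃ₜ X) := (typeCon α).Quotient

/-- The class `[f] ∈ T(α)` of `f ∈ C(X, ℕ)`. -/
def cls (α : Γ →* X ≃ₜ X) (f : C(X, ℕ)) : TypeSemigroup α := (typeCon α).toQuotient f

/-- The algebraic preorder on `T(α)`: `a ≤ b` iff `a + c = b` for some `c`. -/
def tle (α : Γ →* X ≃ₜ X) (a b : TypeSemigroup α) : Prop := ∃ c, a + c = b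

/-- `T(α)` is unperforated: `n • a ≤ n • b` implies `a ≤ b` for all `n ≥ 1`. -/
def IsUnperforated (α : Γ →* X ≃ₜ X) : Prop :=
  ∀ (a b : TypeSemigroup α) (n : ℕ), 1 ≤ n → tle α (n • a) (n • b) → tle α a b

/-- `T(α)` is almost unperforated: `(n+1) • a ≤ n • b` implies `a ≤ b`. -/
def IsAlmostUnperforated (α : Γ →* X ≃ₜ X) : Prop :=
  ∀ (a b : TypeSemigroup α) (n : ℕ), tle α ((n + 1) • a) (n • b) → tle α a b

/-- `T(α)` is cancellative: `a + b = a + c` implies `b = c`. -/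
def IsCancellative (α : Γ →* X ≃ₜ X) : Prop :=
  ∀ a b c : TypeSemigroup α, a + b = a + c → b = c

/-- The algebraic preorder on `T(α)` is a partial order, i.e. it is antisymmetric. -/
def TleAntisymm (α : Γ →* X ≃ₜ X) : Prop :=
  ∀ a b : TypeSemigroup α, tle α a b → tle α b a → a = b

/-- `b` is an order unit of `T(α)`: every `a` satisfies `a ≤ k • b` for some `k ∈ ℕ`. -/
def IsOrderUnit (α : Γ →* X ≃ₜ X) (b : TypeSemigroup α) : Prop :=
  ∀ a : TypeSemigroup α, ∃ k : ℕ, tle α a (k • b)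

/-- A state on `T(α)`: an additive map to `[0,∞]` sending `0` to `0`. -/
def IsState (α : Γ →* X ≃ₜ X) (ν : TypeSemigroup α → ℝ≥0∞) : Prop :=
  ν 0 = 0 ∧ ∀ a b : TypeSemigroup α, ν (a + b) = ν a + ν b

/-- `M(α)`: the set of `Γ`-invariant Radon (regular Borel) probability measures on `X`. -/
def invRadon (α : Γ →* X ≃ₜ X) : Set (@Measure X (borel X)) :=
  letI : MeasurableSpace X := borel X
  {μ : Measure X | IsProbabilityMeasure μ ∧ μ.Regular ∧ ∀ γ : Γ, Measure.map ⇑(α γ) μ = μ}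

/-- The set of `Γ`-invariant Borel probability measures on `X`. -/
def invBorel (α : Γ →* X ≃ₜ X) : Set (@Measure X (borel X)) :=
  letI : MeasurableSpace X := borel X
  {μ : Measure X | IsProbabilityMeasure μ ∧ ∀ γ : Γ, Measure.map ⇑(α γ) μ = μ}

/-- `μ([f]) = ∫ f dμ`, the value of (the state associated with) a measure on the class of
`f ∈ C(X, ℕ)`. -/
noncomputable def intOf {X : Type*} [TopologicalSpace X] (μ : @Measure X (borel X))
    (f : C(X, ℕ)) : ℝ :=
  letI : MeasurableSpace X := borel X
  ∫ x, (f x : ℝ) ∂μ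

/-- `A` is subequidecomposable to `B`: there are a partition `A = A₁ ⊔ ⋯ ⊔ Aₙ` into clopen
sets and `γ₁, …, γₙ ∈ Γ` with `γ₁A₁, …, γₙAₙ` pairwise disjoint and contained in `B`. -/
def Subequidecomposable (α : Γ →* X ≃ₜ X) (A B : Set X) : Prop :=
  ∃ (n : ℕ) (P : Fin n → Set X) (γ : Fin n → Γ),
    (∀ i, IsClopen (P i)) ∧ (Pairwise fun i j => Disjoint (P i) (P j)) ∧
    (⋃ i, P i) = A ∧
    (Pairwise fun i j => Disjoint (⇑(α (γ i)) '' P i) (⇑(α (γ j)) '' P j)) ∧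
    ∀ i, ⇑(α (γ i)) '' P i ⊆ B

/-- Dynamical comparison (with respect to invariant Radon probability measures): for all
clopen `A`, `B` with `B` nonempty and `μ(A) < μ(B)` for every `μ ∈ M(α)`, `A` is
subequidecomposable to `B`. -/
def DynComparison (α : Γ →* X ≃ₜ X) : Prop :=
  ∀ A B : Set X, IsClopen A → IsClopen B → B.Nonempty →
    (∀ μ ∈ invRadon α, μ A < μ B) → Subequidecomposable α A B

/-- Dynamical comparison (with respect to invariant Borel probability measures). -/
def DynComparisonBorel (α : Γ →* X ≃ₜ X) : Prop :=
  ∀ A B : Set X, IsClopen A → IsClopen B → B.Nonempty →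
    (∀ μ ∈ invBorel α, μ A < μ B) → Subequidecomposable α A B

/-- The action `α` is minimal: the only closed invariant subsets are `∅` and `X`. -/
def IsMinimalAction (α : Γ →* X ≃ₜ X) : Prop :=
  ∀ F : Set X, IsClosed F → (∀ γ : Γ, ⇑(α γ) '' F ⊆ F) → F = ∅ ∨ F = Set.univ

/-- Membership in the topological full group `⟦α⟧`: `g` coincides with elements of the
action on the pieces of a finite clopen partition of `X`. -/
def InTopFullGroup (α : Γ →* X ≃ₜ X) (g : X ≃ₜ X) : Prop :=
  ∃ (n : ℕ) (P : Fin n → Set X) (γ : Fin n → Γ),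
    (∀ i, IsClopen (P i)) ∧ (Pairwise fun i j => Disjoint (P i) (P j)) ∧
    (⋃ i, P i) = Set.univ ∧ ∀ i, ∀ x ∈ P i, g x = α (γ i) x

/-- `⟦α⟧` admits a dense locally finite subgroup: there is a subgroup `Λ` of `Homeo(X)`
contained in `⟦α⟧`, locally finite (all its finitely generated subgroups are finite), and
dense in `⟦α⟧` for the topology whose basic neighborhoods of `h` are
`{g : g A = h A for all A ∈ 𝒜}`, `𝒜` ranging over finite clopen partitions of `X`. -/
def HasDenseLocallyFiniteSubgroup (α : Γ →* X ≃ₜ X) : Prop :=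
  ∃ Λ : Subgroup (X ≃ₜ X),
    ((Λ : Set (X ≃ₜ X)) ⊆ {g | InTopFullGroup α g}) ∧
    (∀ s : Finset (X ≃ₜ X), (s : Set (X ≃ₜ X)) ⊆ (Λ : Set (X ≃ₜ X)) →
      ((Subgroup.closure (s : Set (X ≃ₜ X)) : Subgroup (X ≃ₜ X)) : Set (X ≃ₜ X)).Finite) ∧
    ∀ g : X ≃ₜ X, InTopFullGroup α g →
      ∀ (n : ℕ) (P : Fin n → Set X), (∀ i, IsClopen (P i)) →
        (Pairwise fun i j => Disjoint (P i) (P j)) → (⋃ i, P i) = Set.univ →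
        ∃ l ∈ Λ, ∀ i, ⇑l '' P i = ⇑g '' P i

end Defs

/-- The topology on `Homeo(X)` whose basic neighborhoods of `h` are the sets
`{g : g A = h A for all A ∈ 𝒜}`, for `𝒜` a finite clopen partition of `X`; equivalently,
the topology generated by the sets `{g : g '' A = B}` for `A`, `B` clopen. -/
def homeoTop (X : Type*) [TopologicalSpace X] : TopologicalSpace (X ≃ₜ X) :=
  TopologicalSpace.generateFrom
    {U | ∃ A B : Set X, IsClopen A ∧ IsClopen B ∧ U = {g : X ≃ₜ X | ⇑g '' A = B}}

/-- The topology on the space `A(Γ)` of actions of `Γ` on `X`, induced from the product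
topology on `Homeo(X)^Γ`. -/
def actionTop (Γ : Type*) [Group Γ] (X : Type*) [TopologicalSpace X] :
    TopologicalSpace (Γ →* (X ≃ₜ X)) :=
  letI := homeoTop X
  TopologicalSpace.induced (fun φ : Γ →* (X ≃ₜ X) => ⇑φ) Pi.topologicalSpace


section Alg

variable {Γ : Type*} [Group Γ] {X : Type*} [TopologicalSpace X]

theorem actC_apply (α : Γ →* X ≃ₜ X) (γ : Γ) (f : C(X, ℕ)) (x : X) :
    actC α γ f x = f (α γ⁻¹ x) := rfl

theorem act_mul (α : Γ →* X ≃ₜ X) (γ δ : Γ) (x : X) : α (γ * δ) x = α γ (α δ x) := by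
  rw [map_mul]; rfl

theorem act_one (α : Γ →* X ≃ₜ X) (x : X) : α 1 x = x := by
  rw [map_one]; rfl

theorem act_inv_act (α : Γ →* X ≃ₜ X) (γ : Γ) (x : X) : α γ⁻¹ (α γ x) = x := by
  rw [← act_mul, inv_mul_cancel, act_one]

theorem act_act_inv (α : Γ →* X ≃ₜ X) (γ : Γ) (x : X) : α γ (α γ⁻¹ x) = x := by
  rw [← act_mul, mul_inv_cancel, act_one]

theorem actC_mul (α : Γ →* X ≃ₜ X) (γ δ : Γ) (f : C(X, ℕ)) :
    actC α (γ * δ) f = actC α γ (actC α δ f) := by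
  ext x; simp only [actC_apply, mul_inv_rev, act_mul]

theorem actC_one (α : Γ →* X ≃ₜ X) (f : C(X, ℕ)) : actC α 1 f = f := by
  ext x; simp only [actC_apply, inv_one, act_one]

theorem actC_inv_actC (α : Γ →* X ≃ₜ X) (γ : Γ) (f : C(X, ℕ)) :
    actC α γ⁻¹ (actC α γ f) = f := by
  rw [← actC_mul, inv_mul_cancel, actC_one]

theorem actC_sum (α : Γ →* X ≃ₜ X) (γ : Γ) {ι : Type*} (s : Finset ι) (f : ι → C(X, ℕ)) :
    actC α γ (∑ i ∈ s, f i) = ∑ i ∈ s, actC α γ (f i) := by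
  ext x; simp only [actC_apply, ContinuousMap.sum_apply]

theorem typeRel_of_fintype (α : Γ →* X ≃ₜ X) {ι : Type*} [Fintype ι] (h : ι → C(X, ℕ))
    (γ : ι → Γ) : TypeRel α (∑ i, h i) (∑ i, actC α (γ i) (h i)) := by
  let e := Fintype.equivFin ι
  refine ⟨Fintype.card ι, fun i => h (e.symm i), fun i => γ (e.symm i), ?_, ?_⟩
  · exact (Equiv.sum_comp e.symm h).symm
  · exact (Equiv.sum_comp e.symm (fun i => actC α (γ i) (h i))).symm

theorem nat_refine {n m : ℕ} (p : Fin n → ℕ) (k : Fin m → ℕ) :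
    ∃ M : Fin n → Fin m → ℕ, (∑ i, p i = ∑ j, k j) →
      (∀ i, p i = ∑ j, M i j) ∧ (∀ j, k j = ∑ i, M i j) := by
  classical
  by_cases hs : ∑ i, p i = ∑ j, k j
  swap
  · exact ⟨fun _ _ => 0, fun h => absurd h hs⟩
  have hc : Fintype.card (Σ i, Fin (p i)) = Fintype.card (Σ j, Fin (k j)) := by simpa using hs
  let e := Fintype.equivOfCardEq hc
  refine ⟨fun i j => (Finset.univ.filter fun s : (Σ i, Fin (p i)) => s.1 = i ∧ (e s).1 = j).card,
    fun _ => ⟨fun i => ?_, fun j => ?_⟩⟩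
  · have h1 : p i = (Finset.univ.filter fun s : (Σ i, Fin (p i)) => s.1 = i).card := by
      rw [← Fintype.card_subtype, Fintype.card_congr (Equiv.sigmaSubtype (β := fun i => Fin (p i)) i)]
      simp
    have h2 := Finset.card_eq_sum_card_fiberwise
      (s := Finset.univ.filter fun s : (Σ i, Fin (p i)) => s.1 = i)
      (t := Finset.univ) (f := fun s => (e s).1) (fun _ _ => by simp)
    rw [h1]
    refine h2.trans ?_
    refine Finset.sum_congr rfl fun j _ => ?_
    rw [Finset.filter_filter]
  · have h1 : k j = (Finset.univ.filter fun s : (Σ i, Fin (k i)) => s.1 = j).card := by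
      rw [← Fintype.card_subtype, Fintype.card_congr (Equiv.sigmaSubtype (β := fun i => Fin (k i)) j)]
      simp
    have h1' : k j = (Finset.univ.filter fun s : (Σ i, Fin (p i)) => (e s).1 = j).card := by
      rw [h1]
      symm
      refine Finset.card_bij (fun s _ => e s) ?_ ?_ ?_
      · intro a ha; simpa using ha
      · intro a _ b _ h; exact e.injective h
      · intro b hb; exact ⟨e.symm b, by simpa using hb, by simp⟩
    have h2 := Finset.card_eq_sum_card_fiberwise
      (s := Finset.univ.filter fun s : (Σ i, Fin (p i)) => (e s).1 = j)
      (t := Finset.univ) (f := fun s => s.1) (fun _ _ => by simp)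
    rw [h1']
    refine h2.trans ?_
    refine Finset.sum_congr rfl fun i _ => ?_
    rw [Finset.filter_filter]
    congr 1
    ext s
    simp only [Finset.mem_filter, Finset.mem_univ, true_and]
    rw [and_comm]

theorem C_refine {n m : ℕ} (p : Fin n → C(X, ℕ)) (k : Fin m → C(X, ℕ))
    (h : ∑ i, p i = ∑ j, k j) : ∃ M : Fin n → Fin m → C(X, ℕ),
      (∀ i, p i = ∑ j, M i j) ∧ (∀ j, k j = ∑ i, M i j) := by
  choose M hM using fun q : (Fin n → ℕ) × (Fin m → ℕ) => nat_refine q.1 q.2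
  have hx : ∀ x, ∑ i, p i x = ∑ j, k j x := fun x => by
    simpa [ContinuousMap.sum_apply] using congrArg (fun f : C(X, ℕ) => f x) h
  have hcont : Continuous fun x => ((fun i => p i x, fun j => k j x) : (Fin n → ℕ) × (Fin m → ℕ)) := by
    fun_prop
  refine ⟨fun i j => ⟨fun x => M (fun i => p i x, fun j => k j x) i j,
    (continuous_of_discreteTopology (f := fun q => M q i j)).comp hcont⟩, fun i => ?_, fun j => ?_⟩
  · ext x
    simpa [ContinuousMap.sum_apply] using (hM (fun i => p i x, fun j => k j x) (hx x)).1 i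
  · ext x
    simpa [ContinuousMap.sum_apply] using (hM (fun i => p i x, fun j => k j x) (hx x)).2 j

theorem TypeRel.symm' {α : Γ →* X ≃ₜ X} {f g : C(X, ℕ)} (h : TypeRel α f g) : TypeRel α g f := by
  obtain ⟨n, h, γ, rfl, rfl⟩ := h
  refine ⟨n, fun i => actC α (γ i) (h i), fun i => (γ i)⁻¹, rfl, ?_⟩
  simp only [actC_inv_actC]

theorem TypeRel.trans' {α : Γ →* X ≃ₜ X} {f g l : C(X, ℕ)} (h : TypeRel α f g)
    (h' : TypeRel α g l) : TypeRel α f l := by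
  obtain ⟨n, h, γ, rfl, rfl⟩ := h
  obtain ⟨m, k, δ, hk, rfl⟩ := h'
  obtain ⟨M, hM1, hM2⟩ := C_refine _ _ hk
  have := typeRel_of_fintype α (ι := Fin n × Fin m) (fun q => actC α (γ q.1)⁻¹ (M q.1 q.2))
    (fun q => δ q.2 * γ q.1)
  convert this using 1
  · rw [Fintype.sum_prod_type]
    refine Finset.sum_congr rfl fun i _ => ?_
    simp only
    rw [← actC_sum, ← hM1, actC_inv_actC]
  · rw [Fintype.sum_prod_type_right]
    refine Finset.sum_congr rfl fun j _ => ?_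
    rw [hM2 j, actC_sum]
    refine Finset.sum_congr rfl fun i _ => ?_
    simp only
    rw [actC_mul, ← actC_mul α (γ i), mul_inv_cancel, actC_one]

theorem TypeRel.refl' (α : Γ →* X ≃ₜ X) (f : C(X, ℕ)) : TypeRel α f f := by
  refine ⟨1, fun _ => f, fun _ => 1, by simp, by simp [actC_one]⟩

theorem TypeRel.add' {α : Γ →* X ≃ₜ X} {f g f' g' : C(X, ℕ)} (h : TypeRel α f g)
    (h' : TypeRel α f' g') : TypeRel α (f + f') (g + g') := by
  obtain ⟨n, h, γ, rfl, rfl⟩ := h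
  obtain ⟨m, k, δ, rfl, rfl⟩ := h'
  have := typeRel_of_fintype α (ι := Fin n ⊕ Fin m) (Sum.elim h k) (Sum.elim γ δ)
  simpa using this

theorem cls_eq_iff (α : Γ →* X ≃ₜ X) (f g : C(X, ℕ)) : cls α f = cls α g ↔ TypeRel α f g := by
  let c : AddCon C(X, ℕ) :=
    { r := TypeRel α
      iseqv := ⟨TypeRel.refl' α, TypeRel.symm', TypeRel.trans'⟩
      add' := TypeRel.add' }
  have hc : typeCon α = c := AddCon.addConGen_of_addCon c
  have : cls α f = cls α g ↔ typeCon α f g := AddCon.eq _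
  rw [this, hc]
  rfl

theorem cls_add (α : Γ →* X ≃ₜ X) (f g : C(X, ℕ)) : cls α (f + g) = cls α f + cls α g := rfl

theorem cls_zero (α : Γ →* X ≃ₜ X) : cls α 0 = 0 := rfl

theorem cls_surj (α : Γ →* X ≃ₜ X) (a : TypeSemigroup α) : ∃ f, cls α f = a := by
  induction a using AddCon.induction_on with
  | H f => exact ⟨f, rfl⟩

theorem cls_nsmul (α : Γ →* X ≃ₜ X) (n : ℕ) (f : C(X, ℕ)) : cls α (n • f) = n • cls α f := by
  induction n with
  | zero => simp [cls_zero]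
  | succ n ih => rw [succ_nsmul, succ_nsmul, cls_add, ih]

theorem cls_sum (α : Γ →* X ≃ₜ X) {ι : Type*} (s : Finset ι) (f : ι → C(X, ℕ)) :
    cls α (∑ i ∈ s, f i) = ∑ i ∈ s, cls α (f i) := by
  classical
  induction s using Finset.induction_on with
  | empty => simp [cls_zero]
  | insert a s ha ih => rw [Finset.sum_insert ha, Finset.sum_insert ha, cls_add, ih]

theorem cls_actC (α : Γ →* X ≃ₜ X) (γ : Γ) (f : C(X, ℕ)) : cls α (actC α γ f) = cls α f := by
  rw [cls_eq_iff]
  exact TypeRel.symm' ⟨1, fun _ => f, fun _ => γ, by simp, by simp⟩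

theorem tle_trans {α : Γ →* X ≃ₜ X} {a b c : TypeSemigroup α} (h : tle α a b) (h' : tle α b c) :
    tle α a c := by
  obtain ⟨x, rfl⟩ := h
  obtain ⟨y, rfl⟩ := h'
  exact ⟨x + y, by rw [add_assoc]⟩

theorem tle_refl {α : Γ →* X ≃ₜ X} (a : TypeSemigroup α) : tle α a a := ⟨0, add_zero a⟩

theorem tle_add {α : Γ →* X ≃ₜ X} {a b c d : TypeSemigroup α} (h : tle α a b) (h' : tle α c d) :
    tle α (a + c) (b + d) := by
  obtain ⟨x, rfl⟩ := h
  obtain ⟨y, rfl⟩ := h'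
  exact ⟨x + y, by abel⟩

theorem tle_nsmul {α : Γ →* X ≃ₜ X} {a b : TypeSemigroup α} (h : tle α a b) (n : ℕ) :
    tle α (n • a) (n • b) := by
  obtain ⟨x, rfl⟩ := h
  exact ⟨n • x, by rw [nsmul_add]⟩

theorem tle_nsmul_right {α : Γ →* X ≃ₜ X} (a : TypeSemigroup α) {n m : ℕ} (h : n ≤ m) :
    tle α (n • a) (m • a) := by
  obtain ⟨k, rfl⟩ := Nat.exists_eq_add_of_le h
  exact ⟨k • a, by rw [add_nsmul]⟩

theorem exists_add_of_le {f g : C(X, ℕ)} (h : ∀ x, f x ≤ g x) : ∃ k : C(X, ℕ), f + k = g := by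
  refine ⟨⟨fun x => g x - f x, ?_⟩, ?_⟩
  · exact (continuous_of_discreteTopology (f := fun q : ℕ × ℕ => q.1 - q.2)).comp
      (g.continuous.prodMk f.continuous)
  · ext x
    have := h x
    simp; omega

theorem tle_cls_of_le (α : Γ →* X ≃ₜ X) {f g : C(X, ℕ)} (h : ∀ x, f x ≤ g x) :
    tle α (cls α f) (cls α g) := by
  obtain ⟨k, rfl⟩ := exists_add_of_le h
  exact ⟨cls α k, rfl⟩

/-- Indicator function of a clopen set. -/
noncomputable def ind (U : Set X) (hU : IsClopen U) : C(X, ℕ) :=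
  ⟨U.indicator 1, (IsLocallyConstant.const 1 |>.continuous).indicator (by
    intro x hx; simp [hU.frontier_eq] at hx)⟩

theorem ind_mem {U : Set X} (hU : IsClopen U) {x : X} (hx : x ∈ U) : ind U hU x = 1 := by
  simp [ind, hx]

theorem ind_notMem {U : Set X} (hU : IsClopen U) {x : X} (hx : x ∉ U) : ind U hU x = 0 := by
  simp [ind, hx]

theorem ind_le_one {U : Set X} (hU : IsClopen U) (x : X) : ind U hU x ≤ 1 := by
  by_cases hx : x ∈ U
  · rw [ind_mem hU hx]
  · rw [ind_notMem hU hx]; omega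

theorem isClopen_pre (f : C(X, ℕ)) (S : Set ℕ) : IsClopen {x | f x ∈ S} :=
  (isClopen_discrete S).preimage f.continuous

/-- `tle` of indicators gives subequidecomposability. -/
theorem subeq_of_tle (α : Γ →* X ≃ₜ X) {A B : Set X} (hA : IsClopen A) (hB : IsClopen B)
    (h : tle α (cls α (ind A hA)) (cls α (ind B hB))) : Subequidecomposable α A B := by
  obtain ⟨c, hc⟩ := h
  obtain ⟨c, rfl⟩ := cls_surj α c
  rw [← cls_add, cls_eq_iff] at hc
  obtain ⟨n, h, γ, h1, h2⟩ := hc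
  have h1' : ∀ x, ind A hA x + c x = ∑ i, h i x := fun x => by
    simpa [ContinuousMap.sum_apply] using congrArg (fun f : C(X, ℕ) => f x) h1
  have h2' : ∀ x, ind B hB x = ∑ i, h i (α (γ i)⁻¹ x) := fun x => by
    simpa [ContinuousMap.sum_apply, actC_apply] using congrArg (fun f : C(X, ℕ) => f x) h2
  let E : Fin n → Set X := fun i => {x | h i x ∈ ({0}ᶜ : Set ℕ)}
  have hE : ∀ i, IsClopen (E i) := fun i => isClopen_pre _ _
  refine ⟨n, fun i => (A ∩ E i) \ ⋃ j : {j // j < i}, E j, γ, ?_, ?_, ?_, ?_, ?_⟩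
  · intro i
    exact (hA.inter (hE i)).diff (isClopen_iUnion_of_finite fun j => hE j)
  · intro i j hij
    rw [Set.disjoint_left]
    rintro x ⟨⟨hxA, hxi⟩, hxi'⟩ ⟨⟨_, hxj⟩, hxj'⟩
    rcases lt_or_gt_of_ne hij with hlt | hlt
    · exact hxj' (Set.mem_iUnion.2 ⟨⟨i, hlt⟩, hxi⟩)
    · exact hxi' (Set.mem_iUnion.2 ⟨⟨j, hlt⟩, hxj⟩)
  · ext x
    constructor
    · intro hx
      obtain ⟨i, hi⟩ := Set.mem_iUnion.1 hx
      exact hi.1.1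
    · intro hx
      have hex : ∃ i, x ∈ E i := by
        by_contra hcon
        push Not at hcon
        have h0 : ∑ i, h i x = 0 := Finset.sum_eq_zero fun i _ => by
          have := hcon i
          simpa [E] using this
        have := h1' x
        rw [ind_mem hA hx] at this
        omega
      obtain ⟨i, hi, hmin⟩ := WellFounded.has_min (wellFounded_lt (α := Fin n)) {i | x ∈ E i} hex
      refine Set.mem_iUnion.2 ⟨i, ⟨hx, hi⟩, ?_⟩
      intro hx'
      obtain ⟨⟨j, hj⟩, hxj⟩ := Set.mem_iUnion.1 hx'
      exact hmin j hxj hj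
  · intro i j hij
    rw [Set.disjoint_left]
    rintro _ ⟨x, hx, rfl⟩ ⟨y, hy, hyx⟩
    have hs := h2' (α (γ i) x)
    have hxi : h i x ≠ 0 := hx.1.2
    have hyj : h j y ≠ 0 := hy.1.2
    have hle := ind_le_one hB (α (γ i) x)
    have : h i (α (γ i)⁻¹ (α (γ i) x)) + h j (α (γ j)⁻¹ (α (γ i) x)) ≤
        ∑ i', h i' (α (γ i')⁻¹ (α (γ i) x)) := by
      rw [← Finset.sum_pair (f := fun i' => h i' (α (γ i')⁻¹ (α (γ i) x))) hij]
      exact Finset.sum_le_sum_of_subset (Finset.subset_univ _)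
    rw [act_inv_act, ← hyx, act_inv_act, hyx] at this
    omega
  · intro i
    rintro _ ⟨x, hx, rfl⟩
    by_contra hxB
    have hs := h2' (α (γ i) x)
    have hxi : h i x ≠ 0 := hx.1.2
    rw [ind_notMem hB hxB] at hs
    have := Finset.single_le_sum (f := fun i' => h i' (α (γ i')⁻¹ (α (γ i) x)))
      (fun _ _ => Nat.zero_le _) (Finset.mem_univ i)
    simp only [act_inv_act] at this
    omega

theorem exists_of_subeq (α : Γ →* X ≃ₜ X) {A B : Set X} (hA : IsClopen A) (hB : IsClopen B)
    (h : Subequidecomposable α A B) :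
    ∃ d : C(X, ℕ), TypeRel α (ind A hA) d ∧ ∀ x, d x ≤ ind B hB x := by
  obtain ⟨n, P, γ, hP, hd, hU, hd', hB'⟩ := h
  refine ⟨∑ i, actC α (γ i) (ind (P i) (hP i)), ⟨n, _, γ, ?_, rfl⟩, ?_⟩
  · ext x
    rw [ContinuousMap.sum_apply]
    by_cases hx : x ∈ A
    · rw [ind_mem hA hx]
      obtain ⟨i, hi⟩ := Set.mem_iUnion.1 (hU ▸ hx)
      rw [Finset.sum_eq_single i, ind_mem _ hi]
      · intro j _ hj
        exact ind_notMem _ fun hxj => Set.disjoint_left.1 (hd hj) hxj hi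
      · simp
    · rw [ind_notMem hA hx]
      symm
      refine Finset.sum_eq_zero fun i _ => ind_notMem _ fun hxi => hx ?_
      rw [← hU]; exact Set.mem_iUnion.2 ⟨i, hxi⟩
  · intro x
    rw [ContinuousMap.sum_apply]
    simp only [actC_apply]
    have key : ∀ i, α (γ i)⁻¹ x ∈ P i → x ∈ α (γ i) '' P i := fun i hi => ⟨_, hi, act_act_inv α _ _⟩
    by_cases hx : ∃ i, α (γ i)⁻¹ x ∈ P i
    · obtain ⟨i, hi⟩ := hx
      rw [ind_mem hB (hB' i (key i hi)), Finset.sum_eq_single i, ind_mem _ hi]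
      · intro j _ hj
        exact ind_notMem _ fun hxj => Set.disjoint_left.1 (hd' hj) (key j hxj) (key i hi)
      · simp
    · push Not at hx
      rw [Finset.sum_eq_zero fun i _ => ind_notMem _ (hx i)]
      exact Nat.zero_le _

/-- By minimality a nonzero function is an order unit. -/
theorem order_unit [CompactSpace X] (α : Γ →* X ≃ₜ X) (hmin : IsMinimalAction α)
    (g : C(X, ℕ)) (hg : g ≠ 0) : ∃ (s : Finset Γ), ∀ x, ∃ γ ∈ s, g (α γ⁻¹ x) ≠ 0 := by
  have hopen : ∀ γ : Γ, IsOpen {x | g (α γ⁻¹ x) ≠ 0} := fun γ =>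
    (isClopen_pre (actC α γ g) {0}ᶜ).2
  have hcov : (⋃ γ : Γ, {x | g (α γ⁻¹ x) ≠ 0}) = Set.univ := by
    have hcl : IsClosed (⋃ γ : Γ, {x | g (α γ⁻¹ x) ≠ 0})ᶜ := (isOpen_iUnion hopen).isClosed_compl
    have hinv : ∀ δ : Γ, α δ '' (⋃ γ : Γ, {x | g (α γ⁻¹ x) ≠ 0})ᶜ ⊆
        (⋃ γ : Γ, {x | g (α γ⁻¹ x) ≠ 0})ᶜ := by
      rintro δ _ ⟨x, hx, rfl⟩
      simp only [Set.mem_compl_iff, Set.mem_iUnion, Set.mem_ofPred_eq, not_exists, not_not] at hx ⊢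
      intro γ
      have := hx (δ⁻¹ * γ)
      rwa [mul_inv_rev, inv_inv, act_mul] at this
    rcases hmin _ hcl hinv with h | h
    · exact Set.compl_empty_iff.1 h
    · exfalso
      apply hg
      ext x
      have hx : x ∈ (⋃ γ : Γ, {x | g (α γ⁻¹ x) ≠ 0})ᶜ := h ▸ Set.mem_univ x
      simp only [Set.mem_compl_iff, Set.mem_iUnion, Set.mem_ofPred_eq, not_exists, not_not] at hx
      simpa [act_one] using hx 1
  obtain ⟨s, hs⟩ := isCompact_univ.elim_finite_subcover _ hopen hcov.ge
  refine ⟨s, fun x => ?_⟩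
  simpa using hs (Set.mem_univ x)

theorem order_unit' [CompactSpace X] (α : Γ →* X ≃ₜ X) (hmin : IsMinimalAction α)
    (g : C(X, ℕ)) (hg : g ≠ 0) : ∃ L : ℕ, tle α (cls α 1) (L • cls α g) := by
  obtain ⟨s, hs⟩ := order_unit α hmin g hg
  refine ⟨s.card, ?_⟩
  have : tle α (cls α 1) (cls α (∑ γ ∈ s, actC α γ g)) := by
    apply tle_cls_of_le
    intro x
    obtain ⟨γ, hγ, hx⟩ := hs x
    rw [ContinuousMap.sum_apply]
    have := Finset.single_le_sum (f := fun γ => actC α γ g x) (fun _ _ => Nat.zero_le _) hγ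
    simp only [actC_apply] at this
    simp only [actC_apply, ContinuousMap.one_apply]
    omega
  rw [cls_sum] at this
  simpa [cls_actC] using this

theorem exists_bound [CompactSpace X] (f : C(X, ℕ)) : ∃ m : ℕ, ∀ x, f x ≤ m := by
  obtain ⟨m, hm⟩ := (isCompact_range f.continuous).bddAbove
  exact ⟨m, fun x => hm ⟨x, rfl⟩⟩

theorem tle_one_nsmul [CompactSpace X] (α : Γ →* X ≃ₜ X) (f : C(X, ℕ)) :
    ∃ m : ℕ, tle α (cls α f) (m • cls α 1) := by
  obtain ⟨m, hm⟩ := exists_bound f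
  refine ⟨m, ?_⟩
  rw [← cls_nsmul]
  exact tle_cls_of_le α fun x => by simpa using hm x

theorem typeRel_zero (α : Γ →* X ≃ₜ X) {f : C(X, ℕ)} (h : TypeRel α f 0) : f = 0 := by
  obtain ⟨n, h, γ, rfl, h2⟩ := h
  refine Finset.sum_eq_zero fun i _ => ?_
  ext x
  have := congrArg (fun f : C(X, ℕ) => f (α (γ i) x)) h2
  simp only [ContinuousMap.sum_apply, actC_apply, ContinuousMap.zero_apply] at this
  have := (Finset.sum_eq_zero_iff.1 this.symm) i (Finset.mem_univ i)
  rwa [act_inv_act] at this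

end Alg
set_option linter.unusedSectionVars false

section Meas

variable {Γ : Type*} [Group Γ] {X : Type*} [TopologicalSpace X] [CompactSpace X] [T2Space X]

theorem integrable_C [MeasurableSpace X] [BorelSpace X] (μ : Measure X) [IsFiniteMeasure μ]
    (f : C(X, ℕ)) : Integrable (fun x => (f x : ℝ)) μ := by
  have hc : Continuous fun x => (f x : ℝ) := continuous_of_discreteTopology.comp f.continuous
  exact hc.integrable_of_hasCompactSupport (HasCompactSupport.of_compactSpace _)

theorem intOf_add (α : Γ →* X ≃ₜ X) {μ : @Measure X (borel X)} (hμ : μ ∈ invRadon α)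
    (f g : C(X, ℕ)) : intOf μ (f + g) = intOf μ f + intOf μ g := by
  let : MeasurableSpace X := borel X
  have : BorelSpace X := ⟨rfl⟩
  obtain ⟨h1, h2, h3⟩ := hμ
  have := integral_add (integrable_C μ f) (integrable_C μ g)
  unfold intOf
  rw [← this]
  simp

theorem intOf_nonneg (μ : @Measure X (borel X)) (f : C(X, ℕ)) : 0 ≤ intOf μ f := by
  let : MeasurableSpace X := borel X
  exact integral_nonneg fun x => Nat.cast_nonneg _

theorem intOf_zero (μ : @Measure X (borel X)) : intOf μ 0 = 0 := by
  simp [intOf]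

theorem intOf_sum (α : Γ →* X ≃ₜ X) {μ : @Measure X (borel X)} (hμ : μ ∈ invRadon α)
    {ι : Type*} (s : Finset ι) (f : ι → C(X, ℕ)) :
    intOf μ (∑ i ∈ s, f i) = ∑ i ∈ s, intOf μ (f i) := by
  classical
  induction s using Finset.induction_on with
  | empty => simp [intOf_zero]
  | insert a s ha ih => rw [Finset.sum_insert ha, Finset.sum_insert ha, intOf_add α hμ, ih]

theorem intOf_nsmul (α : Γ →* X ≃ₜ X) {μ : @Measure X (borel X)} (hμ : μ ∈ invRadon α)
    (n : ℕ) (f : C(X, ℕ)) : intOf μ (n • f) = n * intOf μ f := by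
  induction n with
  | zero => simp [intOf_zero]
  | succ n ih => rw [succ_nsmul, intOf_add α hμ, ih]; push_cast; ring

theorem intOf_mono (α : Γ →* X ≃ₜ X) {μ : @Measure X (borel X)} (hμ : μ ∈ invRadon α)
    {f g : C(X, ℕ)} (h : ∀ x, f x ≤ g x) : intOf μ f ≤ intOf μ g := by
  obtain ⟨k, rfl⟩ := exists_add_of_le h
  rw [intOf_add α hμ]
  linarith [intOf_nonneg μ k]

theorem intOf_actC (α : Γ →* X ≃ₜ X) {μ : @Measure X (borel X)} (hμ : μ ∈ invRadon α)
    (γ : Γ) (f : C(X, ℕ)) : intOf μ (actC α γ f) = intOf μ f := by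
  let : MeasurableSpace X := borel X
  have : BorelSpace X := ⟨rfl⟩
  obtain ⟨h1, h2, h3⟩ := hμ
  unfold intOf
  have hm := h3 γ⁻¹
  have := MeasureTheory.integral_map (μ := μ) (φ := α γ⁻¹) (f := fun x => (f x : ℝ))
    (α γ⁻¹).continuous.measurable.aemeasurable
    (by rw [hm]; exact (integrable_C μ f).aestronglyMeasurable)
  rw [hm] at this
  exact this.symm

theorem intOf_typeRel (α : Γ →* X ≃ₜ X) {μ : @Measure X (borel X)} (hμ : μ ∈ invRadon α)
    {f g : C(X, ℕ)} (h : TypeRel α f g) : intOf μ f = intOf μ g := by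
  obtain ⟨n, h, γ, rfl, rfl⟩ := h
  rw [intOf_sum α hμ, intOf_sum α hμ]
  simp only [intOf_actC α hμ]

theorem intOf_tle (α : Γ →* X ≃ₜ X) {μ : @Measure X (borel X)} (hμ : μ ∈ invRadon α)
    {f g : C(X, ℕ)} (h : tle α (cls α f) (cls α g)) : intOf μ f ≤ intOf μ g := by
  obtain ⟨c, hc⟩ := h
  obtain ⟨c, rfl⟩ := cls_surj α c
  rw [← cls_add, cls_eq_iff] at hc
  rw [← intOf_typeRel α hμ hc, intOf_add α hμ]
  linarith [intOf_nonneg μ c]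

theorem intOf_ind (μ : @Measure X (borel X)) {U : Set X} (hU : IsClopen U) :
    intOf μ (ind U hU) = (μ U).toReal := by
  let : MeasurableSpace X := borel X
  have : BorelSpace X := ⟨rfl⟩
  have : (fun x => ((ind U hU x : ℕ) : ℝ)) = U.indicator 1 := by
    ext x
    by_cases hx : x ∈ U
    · simp [ind_mem hU hx, hx]
    · simp [ind_notMem hU hx, hx]
  unfold intOf
  rw [this]
  exact integral_indicator_one hU.2.measurableSet

theorem intOf_one (α : Γ →* X ≃ₜ X) {μ : @Measure X (borel X)} (hμ : μ ∈ invRadon α) :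
    intOf μ 1 = 1 := by
  let : MeasurableSpace X := borel X
  obtain ⟨h1, h2, h3⟩ := hμ
  unfold intOf
  simp

theorem lt_of_intOf_lt (α : Γ →* X ≃ₜ X) {μ : @Measure X (borel X)} (hμ : μ ∈ invRadon α)
    {A B : Set X} (hA : IsClopen A) (hB : IsClopen B)
    (h : intOf μ (ind A hA) < intOf μ (ind B hB)) : μ A < μ B := by
  let : MeasurableSpace X := borel X
  obtain ⟨h1, h2, h3⟩ := hμ
  rw [intOf_ind, intOf_ind] at h
  exact (ENNReal.toReal_lt_toReal (measure_ne_top μ A) (measure_ne_top μ B)).1 h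

variable [TotallyDisconnectedSpace X]

theorem ext_clopen [MeasurableSpace X] [BorelSpace X] (μ ν : Measure X) [μ.Regular] [ν.Regular]
    (h : ∀ U, IsClopen U → μ U = ν U) : μ = ν := by
  apply Measure.OuterRegular.ext_isOpen
  have key : ∀ (μ ν : Measure X) [μ.Regular] [ν.Regular], (∀ U, IsClopen U → μ U = ν U) →
      ∀ U, IsOpen U → μ U ≤ ν U := by
    intro μ ν _ _ h U hU
    rw [hU.measure_eq_iSup_isCompact]
    refine iSup₂_le fun K hKU => iSup_le fun hK => ?_
    obtain ⟨C, hC, hKC, hCU⟩ := exists_clopen_of_closed_subset_open hK.isClosed hU hKU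
    calc μ K ≤ μ C := measure_mono hKC
      _ = ν C := h C hC
      _ ≤ ν U := measure_mono hCU
  exact fun U hU => le_antisymm (key μ ν h U hU) (key ν μ (fun U hU => (h U hU).symm) U hU)

/-- embedding of `C(X,ℕ)` in `C(X,ℝ)`. -/
def toR (f : C(X, ℕ)) : C(X, ℝ) :=
  ⟨fun x => (f x : ℝ), continuous_of_discreteTopology.comp f.continuous⟩


theorem toR_apply (f : C(X, ℕ)) (x : X) : toR f x = (f x : ℝ) := rfl

theorem exists_measure [Nonempty X] (α : Γ →* X ≃ₜ X) (ψ : C(X, ℝ) →ₗ[ℝ] ℝ)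
    (hpos : ∀ f : C(X, ℝ), (∀ x, 0 ≤ f x) → 0 ≤ ψ f) (h1 : ψ 1 = 1)
    (hinv : ∀ f g : C(X, ℕ), cls α f = cls α g → ψ (toR f) = ψ (toR g)) :
    ∃ μ ∈ invRadon α, ∀ U (hU : IsClopen U), (μ U).toReal = ψ (toR (ind U hU)) := by
  let : MeasurableSpace X := borel X
  have : BorelSpace X := ⟨rfl⟩
  let Λ₀ : CompactlySupportedContinuousMap X ℝ →ₗ[ℝ] ℝ :=
    { toFun := fun f => ψ f.toContinuousMap
      map_add' := fun f g => ψ.map_add _ _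
      map_smul' := fun c f => ψ.map_smul c _ }
  let Λ : CompactlySupportedContinuousMap X ℝ →ₚ[ℝ] ℝ := PositiveLinearMap.mk₀ Λ₀
    (fun f hf => hpos _ fun x => hf x)
  let μ := RealRMK.rieszMeasure Λ
  have hint : ∀ f : C(X, ℝ), ∫ x, f x ∂μ = ψ f := fun f =>
    RealRMK.integral_rieszMeasure Λ ⟨f, HasCompactSupport.of_compactSpace _⟩
  have hU : ∀ U (hU : IsClopen U), (μ U).toReal = ψ (toR (ind U hU)) := by
    intro U hU
    rw [← hint, ← intOf_ind μ hU]
    rfl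
  have hprob : IsProbabilityMeasure μ := by
    constructor
    have h := hint 1
    simp only [ContinuousMap.one_apply, integral_const, smul_eq_mul, mul_one, h1] at h
    have := (ENNReal.toReal_eq_one_iff _).1 h
    exact this
  refine ⟨μ, ⟨hprob, inferInstance, fun γ => ?_⟩, hU⟩
  have : (Measure.map (α γ) μ).Regular := Measure.Regular.map (α γ)
  refine ext_clopen _ _ fun U hUc => ?_
  rw [Measure.map_apply (α γ).continuous.measurable hUc.2.measurableSet]
  have hc : IsClopen (α γ ⁻¹' U) := hUc.preimage (α γ).continuous
  rw [← ENNReal.toReal_eq_toReal_iff' (measure_ne_top _ _) (measure_ne_top _ _), hU _ hc, hU _ hUc]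
  apply hinv
  have : ind _ hc = actC α γ⁻¹ (ind U hUc) := by
    ext x
    rw [actC_apply, inv_inv]
    rfl
  rw [this, cls_actC]

end Meas

section HB

variable {Γ : Type*} [Group Γ] {X : Type*} [TopologicalSpace X] [CompactSpace X] [T2Space X]
  [TotallyDisconnectedSpace X]

theorem toR_add (f g : C(X, ℕ)) : toR (f + g) = toR f + toR g := by
  ext x; simp [toR_apply]

theorem toR_nsmul (n : ℕ) (f : C(X, ℕ)) : toR (n • f) = (n : ℝ) • toR f := by
  ext x; simp [toR_apply]

/-- integer cone -/
def coneM (α : Γ →* X ≃ₜ X) (a b : C(X, ℕ)) : Set C(X, ℝ) :=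
  {p | ∃ (f g : C(X, ℕ)) (k : ℕ), cls α f = cls α g ∧
    p = toR f - toR g + (k : ℝ) • (toR b - toR a)}

theorem coneM_add (α : Γ →* X ≃ₜ X) (a b : C(X, ℕ)) {p q : C(X, ℝ)} (hp : p ∈ coneM α a b)
    (hq : q ∈ coneM α a b) : p + q ∈ coneM α a b := by
  obtain ⟨f, g, k, h, rfl⟩ := hp
  obtain ⟨f', g', k', h', rfl⟩ := hq
  refine ⟨f + f', g + g', k + k', by rw [cls_add, cls_add, h, h'], ?_⟩
  rw [toR_add, toR_add]; push_cast; module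

theorem coneM_smul (α : Γ →* X ≃ₜ X) (a b : C(X, ℕ)) {p : C(X, ℝ)} (hp : p ∈ coneM α a b)
    (n : ℕ) : (n : ℝ) • p ∈ coneM α a b := by
  obtain ⟨f, g, k, h, rfl⟩ := hp
  refine ⟨n • f, n • g, n * k, by rw [cls_nsmul, cls_nsmul, h], ?_⟩
  rw [toR_nsmul, toR_nsmul]; push_cast; module

/-- rational cone -/
def coneP (α : Γ →* X ≃ₜ X) (a b : C(X, ℕ)) : Set C(X, ℝ) :=
  {p | ∃ n : ℕ, 0 < n ∧ (n : ℝ) • p ∈ coneM α a b}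

theorem coneP_add (α : Γ →* X ≃ₜ X) (a b : C(X, ℕ)) {p q : C(X, ℝ)} (hp : p ∈ coneP α a b)
    (hq : q ∈ coneP α a b) : p + q ∈ coneP α a b := by
  obtain ⟨n, hn, h⟩ := hp
  obtain ⟨m, hm, h'⟩ := hq
  refine ⟨n * m, Nat.mul_pos hn hm, ?_⟩
  have := coneM_add α a b (coneM_smul α a b h m) (coneM_smul α a b h' n)
  convert this using 1
  push_cast; module

theorem coneW_add (α : Γ →* X ≃ₜ X) (a b : C(X, ℕ)) {p q : C(X, ℝ)}
    (hp : p ∈ closure (coneP α a b)) (hq : q ∈ closure (coneP α a b)) :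
    p + q ∈ closure (coneP α a b) :=
  map_mem_closure₂ continuous_add hp hq fun _ h _ h' => coneP_add α a b h h'

theorem coneW_smul (α : Γ →* X ≃ₜ X) (a b : C(X, ℕ)) {p : C(X, ℝ)}
    (hp : p ∈ closure (coneP α a b)) {r : ℝ} (hr : 0 ≤ r) :
    r • p ∈ closure (coneP α a b) := by
  have key : ∀ p ∈ coneP α a b, r • p ∈ closure (coneP α a b) := by
    intro p hp
    have ht := ((tendsto_nat_floor_mul_div_atTop hr).comp
      (tendsto_natCast_atTop_atTop (R := ℝ))).smul_const p
    refine mem_closure_of_tendsto ht ?_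
    filter_upwards [Filter.eventually_gt_atTop 0] with N hN
    obtain ⟨n, hn, h⟩ := hp
    refine ⟨n * N, Nat.mul_pos hn hN, ?_⟩
    have := coneM_smul α a b h ⌊r * N⌋₊
    convert this using 1
    have hN' : (N : ℝ) ≠ 0 := by positivity
    simp only [Function.comp, smul_smul]
    congr 1
    push_cast
    field_simp
  have := map_mem_closure (continuous_const_smul r) hp key
  rwa [closure_closure] at this

theorem exists_state [Nonempty X] (α : Γ →* X ≃ₜ X) (a b : C(X, ℕ))
    (hno : ¬ ∃ (f g u : C(X, ℕ)) (k : ℕ), cls α f = cls α g ∧ (∀ x, 1 ≤ u x) ∧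
      f + k • b = g + k • a + u) :
    ∃ ψ : C(X, ℝ) →ₗ[ℝ] ℝ, (∀ f : C(X, ℝ), (∀ x, 0 ≤ f x) → 0 ≤ ψ f) ∧ ψ 1 = 1 ∧
      (∀ f g : C(X, ℕ), cls α f = cls α g → ψ (toR f) = ψ (toR g)) ∧
      ψ (toR b) ≤ ψ (toR a) := by
  let S : Set C(X, ℝ) := {f | ∀ x, 0 < f x}
  have hSo : IsOpen S := by
    have := ContinuousMap.isOpen_setOfPred_mapsTo (X := X) (Y := ℝ) (isCompact_univ) (isOpen_Ioi (a := (0:ℝ)))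
    convert this using 1
    ext f
    simp [S, Set.MapsTo]
  have hSc : Convex ℝ S := by
    intro f hf g hg s t hs ht hst x
    have h1 := hf x
    have h2 := hg x
    simp only [ContinuousMap.add_apply, ContinuousMap.smul_apply, smul_eq_mul]
    rcases hs.eq_or_lt with rfl | hs'
    · have : t = 1 := by linarith
      subst this; simpa using h2
    · have := mul_pos hs' h1
      have := mul_nonneg ht h2.le
      linarith
  have hWc : Convex ℝ (closure (coneP α a b)) := fun p hp q hq s t hs ht _ =>
    coneW_add α a b (coneW_smul α a b hp hs) (coneW_smul α a b hq ht)
  have hMW : ∀ p ∈ coneM α a b, p ∈ closure (coneP α a b) := fun p hp =>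
    subset_closure ⟨1, one_pos, by simpa using hp⟩
  have hdisj : Disjoint S (closure (coneP α a b)) := by
    rw [Set.disjoint_left]
    intro p hpS hpW
    obtain ⟨q, hqS, n, hn, f, g, k, hfg, hq⟩ := mem_closure_iff.1 hpW S hSo hpS
    have hx : ∀ x, g x + k * a x + 1 ≤ f x + k * b x := by
      intro x
      have h1 : 0 < (n : ℝ) * q x := mul_pos (by exact_mod_cast hn) (hqS x)
      have h2 := congrArg (fun f : C(X, ℝ) => f x) hq
      simp only [ContinuousMap.add_apply, ContinuousMap.smul_apply, ContinuousMap.sub_apply,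
        smul_eq_mul, toR_apply] at h2
      have h3 : (g x + k * a x : ℝ) < f x + k * b x := by rw [h2] at h1; linarith
      have h4 : g x + k * a x < f x + k * b x := by exact_mod_cast h3
      omega
    obtain ⟨u, hu⟩ := exists_add_of_le (f := g + k • a) (g := f + k • b) (fun x => by
      have := hx x
      simp; omega)
    refine hno ⟨f, g, u, k, hfg, fun x => ?_, hu.symm⟩
    have h1 := hx x
    have h2 := congrArg (fun f : C(X, ℕ) => f x) hu
    simp at h2
    omega
  obtain ⟨φ, u, hφS, hφW⟩ := geometric_hahn_banach_open hSc hSo hWc hdisj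
  have h0 : (0 : C(X, ℝ)) ∈ closure (coneP α a b) := hMW _ ⟨0, 0, 0, rfl, by simp⟩
  have hu : u ≤ 0 := by simpa using hφW 0 h0
  have hφW' : ∀ w ∈ closure (coneP α a b), 0 ≤ φ w := by
    intro w hw
    by_contra hneg
    push Not at hneg
    have := hφW _ (coneW_smul α a b hw (r := (u - 1) / φ w)
      (div_nonneg_of_nonpos (by linarith) hneg.le))
    rw [map_smul, smul_eq_mul, div_mul_cancel₀ _ hneg.ne] at this
    linarith
  have hφ1 : φ 1 < 0 := lt_of_lt_of_le (hφS 1 fun x => by simp) hu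
  have hφpos : ∀ f : C(X, ℝ), (∀ x, 0 ≤ f x) → φ f ≤ 0 := by
    intro f hf
    by_contra hneg
    push Not at hneg
    have := hφS (f + (φ f / (- φ 1)) • 1) (fun x => by
      have := hf x
      have : 0 < φ f / (- φ 1) := div_pos hneg (by linarith)
      simp; linarith)
    rw [map_add, map_smul, smul_eq_mul, div_neg, neg_mul, div_mul_cancel₀ _ hφ1.ne] at this
    linarith
  have hle : ∀ f g : C(X, ℕ), cls α f = cls α g → φ (toR g) ≤ φ (toR f) := by
    intro f g h
    have := hφW' _ (hMW _ ⟨f, g, 0, h, rfl⟩)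
    simp only [Nat.cast_zero, zero_smul, add_zero, map_sub] at this
    linarith
  refine ⟨(φ 1)⁻¹ • φ.toLinearMap, ?_, ?_, ?_, ?_⟩
  · intro f hf
    simp only [LinearMap.smul_apply, smul_eq_mul, ContinuousLinearMap.coe_coe]
    exact mul_nonneg_of_nonpos_of_nonpos (inv_nonpos.2 hφ1.le) (hφpos f hf)
  · simp [hφ1.ne]
  · intro f g h
    simp only [LinearMap.smul_apply, smul_eq_mul, ContinuousLinearMap.coe_coe]
    rw [le_antisymm (hle f g h) (hle g f h.symm)]
  · simp only [LinearMap.smul_apply, smul_eq_mul, ContinuousLinearMap.coe_coe]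
    have := hφW' _ (hMW _ ⟨0, 0, 1, rfl, rfl⟩)
    simp only [Nat.cast_one, one_smul, sub_self, zero_add, map_sub] at this
    exact mul_le_mul_of_nonpos_left (by linarith) (inv_nonpos.2 hφ1.le)

theorem dyn_of_au [Nonempty X] (α : Γ →* X ≃ₜ X) (hmin : IsMinimalAction α)
    (h : IsAlmostUnperforated α) : DynComparison α := by
  intro A B hA hB hBne hμ
  apply subeq_of_tle α hA hB
  by_cases hno : ∃ (f g u : C(X, ℕ)) (k : ℕ), cls α f = cls α g ∧ (∀ x, 1 ≤ u x) ∧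
      f + k • (ind B hB) = g + k • (ind A hA) + u
  swap
  · exfalso
    obtain ⟨ψ, h1, h2, h3, h4⟩ := exists_state α (ind A hA) (ind B hB) hno
    obtain ⟨μ, hμi, hμU⟩ := exists_measure α ψ h1 h2 h3
    rw [← hμU, ← hμU] at h4
    have hlt := hμ μ hμi
    obtain ⟨i1, i2, i3⟩ := hμi
    exact absurd ((ENNReal.toReal_le_toReal (measure_ne_top μ B) (measure_ne_top μ A)).1 h4)
      (not_le.2 hlt)
  obtain ⟨f, g, u, k, hfg, hu, heq⟩ := hno
  have hBz : ind B hB ≠ 0 := by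
    obtain ⟨x, hx⟩ := hBne
    intro h0
    have := ind_mem hB hx
    rw [h0] at this
    simp at this
  set a := cls α (ind A hA) with ha
  set b := cls α (ind B hB) with hb
  have hue : tle α a (cls α u) := tle_cls_of_le α fun x => (ind_le_one hA x).trans (hu x)
  have heq' : cls α g + k • b = cls α g + (k • a + cls α u) := by
    have := congrArg (cls α) heq
    rw [cls_add, cls_add, cls_add, cls_nsmul, cls_nsmul, hfg] at this
    rw [this, add_assoc]
  have hstep : tle α (cls α g + (k + 1) • a) (cls α g + k • b) := by
    rw [heq', succ_nsmul]
    exact tle_add (tle_refl _) (tle_add (tle_refl _) hue)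
  have hiter : ∀ m : ℕ, tle α (cls α g + m • ((k + 1) • a)) (cls α g + m • (k • b)) := by
    intro m
    induction m with
    | zero => simpa using tle_refl _
    | succ m ih =>
      rw [succ_nsmul _ m, succ_nsmul _ m, ← add_assoc, ← add_assoc]
      refine tle_trans (tle_add ih (tle_refl _)) ?_
      rw [add_right_comm (cls α g) _ ((k + 1) • a), add_right_comm (cls α g) _ (k • b)]
      exact tle_add hstep (tle_refl _)
  obtain ⟨L, hL⟩ := order_unit' α hmin (ind B hB) hBz
  obtain ⟨m₀, hm₀⟩ := tle_one_nsmul α g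
  have hg : tle α (cls α g) ((m₀ * L) • b) := by
    refine tle_trans hm₀ ?_
    rw [mul_nsmul']
    exact tle_nsmul hL m₀
  set K := m₀ * L with hK
  apply h a b (K + (K + 1) * k)
  have h1 : tle α (((K + 1) * (k + 1)) • a) (cls α g + (K + 1) • ((k + 1) • a)) :=
    ⟨cls α g, by rw [mul_nsmul', add_comm]⟩
  have h2 : tle α (cls α g + (K + 1) • (k • b)) ((K + (K + 1) * k) • b) := by
    rw [add_nsmul b K, mul_nsmul' b (K + 1)]
    exact tle_add hg (tle_refl _)
  have h3 := tle_trans h1 (tle_trans (hiter (K + 1)) h2)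
  have : K + (K + 1) * k + 1 = (K + 1) * (k + 1) := by ring
  rw [this]
  exact h3

end HB

section Greedy

variable {Γ : Type*} [Group Γ] {X : Type*} [TopologicalSpace X] [CompactSpace X] [T2Space X]
  [TotallyDisconnectedSpace X]

/-- clopen sets uniformly small for all invariant measures -/
def SmallSet (α : Γ →* X ≃ₜ X) (δ : ℝ) (U : Set X) (hU : IsClopen U) : Prop :=
  ∀ μ ∈ invRadon α, intOf μ (ind U hU) < δ

theorem ind_mono {U V : Set X} (hU : IsClopen U) (hV : IsClopen V) (h : U ⊆ V) (x : X) :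
    ind U hU x ≤ ind V hV x := by
  by_cases hx : x ∈ U
  · rw [ind_mem hU hx, ind_mem hV (h hx)]
  · rw [ind_notMem hU hx]; exact Nat.zero_le _

theorem SmallSet.mono {α : Γ →* X ≃ₜ X} {δ : ℝ} {U V : Set X} {hU : IsClopen U}
    (hV : IsClopen V) (h : SmallSet α δ U hU) (hVU : V ⊆ U) : SmallSet α δ V hV :=
  fun μ hμ => lt_of_le_of_lt (intOf_mono α hμ (ind_mono hV hU hVU)) (h μ hμ)

theorem orbit_infinite [Infinite X] (α : Γ →* X ≃ₜ X) (hmin : IsMinimalAction α) (x : X) :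
    (Set.range fun γ : Γ => α γ x).Infinite := by
  intro hfin
  rcases hmin _ hfin.isClosed (by
    rintro δ _ ⟨_, ⟨γ, rfl⟩, rfl⟩
    exact ⟨δ * γ, act_mul α δ γ x⟩) with h | h
  · have : α 1 x ∈ (Set.range fun γ : Γ => α γ x) := ⟨1, rfl⟩
    rw [h] at this
    exact this
  · rw [h] at hfin
    exact Set.infinite_univ hfin

theorem exists_small [Infinite X] (α : Γ →* X ≃ₜ X) (hmin : IsMinimalAction α) {δ : ℝ}
    (hδ : 0 < δ) (x : X) (O : Set X) (hO : IsOpen O) (hxO : x ∈ O) :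
    ∃ (U : Set X) (hU : IsClopen U), x ∈ U ∧ U ⊆ O ∧ SmallSet α δ U hU := by
  obtain ⟨N, hN⟩ := exists_nat_one_div_lt hδ
  obtain ⟨t, htsub, htcard⟩ := (orbit_infinite α hmin x).exists_subset_card_eq (N + 1)
  obtain ⟨V, hV, hVd⟩ := t.finite_toSet.t2_separation
  have hex : ∀ y ∈ t, ∃ γ : Γ, α γ x = y := fun y hy => htsub hy
  choose! γ hγ using hex
  have hopen : IsOpen (O ∩ ⋂ y ∈ t, α (γ y) ⁻¹' V y) := by
    refine hO.inter (isOpen_biInter_finset fun y _ => ?_)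
    exact (hV y).2.preimage (α (γ y)).continuous
  obtain ⟨U, hU, hxU, hUO⟩ := compact_exists_isClopen_in_isOpen hopen (x := x) (by
    refine ⟨hxO, Set.mem_iInter₂.2 fun y hy => ?_⟩
    rw [Set.mem_preimage, hγ y hy]
    exact (hV y).1)
  refine ⟨U, hU, hxU, fun y hy => (hUO hy).1, fun μ hμ => ?_⟩
  have hle : ∀ z, (∑ y ∈ t, actC α (γ y) (ind U hU)) z ≤ (1 : C(X, ℕ)) z := by
    intro z
    rw [ContinuousMap.sum_apply]
    simp only [actC_apply, ContinuousMap.one_apply]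
    have key : ∀ y ∈ t, α (γ y)⁻¹ z ∈ U → z ∈ V y := by
      intro y hy hz
      have := Set.mem_iInter₂.1 (hUO hz).2 y hy
      rwa [Set.mem_preimage, act_act_inv] at this
    by_cases hz : ∃ y ∈ t, α (γ y)⁻¹ z ∈ U
    · obtain ⟨y, hy, hz⟩ := hz
      rw [Finset.sum_eq_single_of_mem y hy]
      · exact ind_le_one _ _
      · intro y' hy' hne
        refine ind_notMem _ fun hz' => ?_
        exact Set.disjoint_left.1 (hVd hy' hy hne) (key y' hy' hz') (key y hy hz)
    · push Not at hz
      rw [Finset.sum_eq_zero fun y hy => ind_notMem _ (hz y hy)]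
      omega
  have h1 := intOf_mono α hμ hle
  rw [intOf_sum α hμ, intOf_one α hμ] at h1
  simp only [intOf_actC α hμ, Finset.sum_const, htcard, nsmul_eq_mul] at h1
  refine lt_of_le_of_lt ?_ hN
  rw [le_div_iff₀ (by positivity)]
  push_cast at h1
  linarith

theorem exists_two [Infinite X] (α : Γ →* X ≃ₜ X) (hmin : IsMinimalAction α) (g : C(X, ℕ))
    (hg : g ≠ 0) : ∃ x y, x ≠ y ∧ g x ≠ 0 ∧ g y ≠ 0 := by
  obtain ⟨s, hs⟩ := order_unit α hmin g hg
  have hx : ∃ x, g x ≠ 0 := by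
    by_contra h
    push Not at h
    exact hg (by ext x; exact h x)
  obtain ⟨x, hx⟩ := hx
  by_contra hcon
  push Not at hcon
  have huniq : ∀ y, g y ≠ 0 → y = x := fun y hy => by
    by_contra hne
    exact hy (hcon x y (Ne.symm hne) hx)
  have : (Set.univ : Set X) ⊆ (fun γ => α γ x) '' (s : Set Γ) := by
    intro z _
    obtain ⟨γ, hγ, hz⟩ := hs z
    refine ⟨γ, hγ, ?_⟩
    simp only
    rw [← huniq _ hz, act_act_inv]
  exact Set.infinite_univ ((s.finite_toSet.image _).subset this)

theorem mul_ind_mem (α : Γ →* X ≃ₜ X) (δ : ℝ) (Q : C(X, ℕ) → Prop) (h0 : Q 0)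
    (hadd : ∀ (C : Set X) (hC : IsClopen C), SmallSet α δ C hC → ∀ f, Q f → Q (ind C hC + f))
    (hsm : ∀ x, ∀ O : Set X, IsOpen O → x ∈ O →
      ∃ (U : Set X) (hU : IsClopen U), x ∈ U ∧ U ⊆ O ∧ SmallSet α δ U hU)
    (f : C(X, ℕ)) : Q f := by
  have hind : ∀ s : Set X, IsCompact s → ∃ V, ∃ hV : IsClopen V, s ⊆ V ∧
      ∀ V' (hV' : IsClopen V'), V' ⊆ V → ∀ k, Q k → Q (f * ind V' hV' + k) := by
    intro s hs
    refine hs.induction_on (p := fun s => ∃ V, ∃ hV : IsClopen V, s ⊆ V ∧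
      ∀ V' (hV' : IsClopen V'), V' ⊆ V → ∀ k, Q k → Q (f * ind V' hV' + k)) ?_ ?_ ?_ ?_
    · refine ⟨∅, isClopen_empty, subset_rfl, fun V' hV' h k hk => ?_⟩
      have : f * ind V' hV' + k = k := by
        ext x
        have : x ∉ V' := fun hx => h hx
        simp [ind_notMem hV' this]
      rwa [this]
    · rintro s t hst ⟨V, hV, htV, h⟩
      exact ⟨V, hV, hst.trans htV, h⟩
    · rintro s t ⟨V, hV, hsV, h⟩ ⟨W, hW, htW, h'⟩
      refine ⟨V ∪ W, hV.union hW, Set.union_subset_union hsV htW, fun V' hV' hsub k hk => ?_⟩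
      have e : f * ind V' hV' + k = f * ind (V' ∩ V) (hV'.inter hV) +
          (f * ind (V' \ V) (hV'.diff hV) + k) := by
        ext x
        by_cases hx : x ∈ V' <;> by_cases hxV : x ∈ V <;> simp [ind, hx, hxV]
      rw [e]
      refine h _ _ Set.inter_subset_right _ (h' _ _ ?_ _ hk)
      rintro x ⟨hx, hxV⟩
      exact (hsub hx).resolve_left hxV
    · intro x _
      obtain ⟨U, hU, hxU, hUO, hsmall⟩ := hsm x {y | f y ∈ ({f x} : Set ℕ)} (isClopen_pre f _).2
        (by simp)
      refine ⟨U, mem_nhdsWithin_of_mem_nhds (hU.2.mem_nhds hxU), U, hU, subset_rfl, ?_⟩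
      intro V' hV' hsub k hk
      have e : f * ind V' hV' + k = (f x) • ind V' hV' + k := by
        ext y
        by_cases hy : y ∈ V'
        · have : f y = f x := hUO (hsub hy)
          simp [this]
        · simp [ind_notMem hV' hy]
      rw [e]
      have : ∀ n : ℕ, Q (n • ind V' hV' + k) := by
        intro n
        induction n with
        | zero => simpa using hk
        | succ n ih =>
          rw [succ_nsmul', add_assoc]
          exact hadd _ _ (hsmall.mono hV' hsub) _ ih
      exact this _
  obtain ⟨V, hV, hs, h⟩ := hind Set.univ isCompact_univ
  have := h Set.univ isClopen_univ hs 0 h0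
  have e : f * ind Set.univ isClopen_univ + 0 = f := by
    ext x; simp [ind]
  rwa [e] at this

theorem au_of_dyn_infinite [Infinite X] (α : Γ →* X ≃ₜ X) (hmin : IsMinimalAction α)
    (hdyn : DynComparison α) : IsAlmostUnperforated α := by
  intro a b n hab
  obtain ⟨f, rfl⟩ := cls_surj α a
  obtain ⟨g, rfl⟩ := cls_surj α b
  rw [← cls_nsmul, ← cls_nsmul] at hab
  by_cases hg : g = 0
  · subst hg
    obtain ⟨c, hc⟩ := hab
    obtain ⟨c, rfl⟩ := cls_surj α c
    rw [smul_zero, ← cls_add, cls_eq_iff] at hc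
    have hz := typeRel_zero α hc
    have : f = 0 := by
      ext x
      have := congrArg (fun f : C(X, ℕ) => f x) hz
      simp at this
      simpa using this.1
    rw [this]
    exact tle_refl _
  obtain ⟨L, hL⟩ := order_unit' α hmin g hg
  obtain ⟨m, hm⟩ := exists_bound g
  set ε : ℝ := 1 / ((L + 1) * (n + 1)) with hε
  have hεpos : 0 < ε := by positivity
  have hgap : ∀ μ ∈ invRadon α, ε + intOf μ f ≤ intOf μ g := by
    intro μ hμ
    have h1 := intOf_tle α hμ hab
    rw [intOf_nsmul α hμ, intOf_nsmul α hμ] at h1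
    rw [← cls_nsmul] at hL
    have h2 := intOf_tle α hμ hL
    rw [intOf_nsmul α hμ, intOf_one α hμ] at h2
    have h3 : ε * (n + 1) ≤ intOf μ g := by
      have : ε * (n + 1) = 1 / (L + 1) := by rw [hε]; field_simp
      rw [this, div_le_iff₀ (by positivity)]
      linarith [intOf_nonneg μ g]
    push_cast at h1
    have h4 : (n + 1 : ℝ) * (ε + intOf μ f) ≤ (n + 1) * intOf μ g := by linarith
    exact le_of_mul_le_mul_left h4 (by positivity)
  set δ : ℝ := ε / (2 * (m + 1)) with hδ
  have hδpos : 0 < δ := by positivity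
  refine mul_ind_mem α δ (fun f => ∀ g' : C(X, ℕ), g' ≠ 0 → (∀ x, g' x ≤ m) →
    (∀ μ ∈ invRadon α, ε + intOf μ f ≤ intOf μ g') → tle α (cls α f) (cls α g'))
    ?_ ?_ (fun x O hO hxO => exists_small α hmin hδpos x O hO hxO) f g hg hm hgap
  · intro g' _ _ _
    exact ⟨cls α g', by rw [cls_zero, zero_add]⟩
  · intro C hC hsm f ih g' hg' hm' hgap'
    obtain ⟨x, y, hxy, hx, hy⟩ := exists_two α hmin g' hg'
    have hsupp : IsClopen {x | g' x ∈ ({0}ᶜ : Set ℕ)} := isClopen_pre g' _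
    set Z := {x | g' x ∈ ({0}ᶜ : Set ℕ)} with hZ
    have hxZ : x ∈ Z := hx
    have hyZ : y ∈ Z := hy
    obtain ⟨U, hU, hxU, hUO, hUs⟩ := exists_small α hmin hδpos x (Z \ {y})
      (hsupp.2.sdiff isClosed_singleton) ⟨hxZ, hxy⟩
    have hD : IsClopen (Z \ U) := hsupp.diff hU
    have hyD : y ∈ Z \ U := ⟨hyZ, fun h => (hUO h).2 rfl⟩
    have hsub : Subequidecomposable α C (Z \ U) := by
      refine hdyn C (Z \ U) hC hD ⟨y, hyD⟩ fun μ hμ => ?_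
      apply lt_of_intOf_lt α hμ hC hD
      have h1 := hsm μ hμ
      have h2 := hUs μ hμ
      have h3 : intOf μ g' ≤ m * (intOf μ (ind (Z \ U) hD) + intOf μ (ind U hU)) := by
        rw [← intOf_add α hμ, ← intOf_nsmul α hμ]
        apply intOf_mono α hμ
        intro z
        have hz := hm' z
        by_cases hzZ : z ∈ Z
        · by_cases hzU : z ∈ U <;> simp [ind, hzZ, hzU, hz]
        · have : g' z = 0 := by simpa [hZ] using hzZ
          rw [this]; exact Nat.zero_le _
      have h4 := hgap' μ hμ
      rw [intOf_add α hμ] at h4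
      have h5 := intOf_nonneg μ f
      have h6 := intOf_nonneg μ (ind C hC)
      by_contra hcon
      push Not at hcon
      have h7 : intOf μ (ind (Z \ U) hD) + intOf μ (ind U hU) ≤ 2 * δ := by linarith
      have h8 : (m : ℝ) * (intOf μ (ind (Z \ U) hD) + intOf μ (ind U hU)) ≤ m * (2 * δ) :=
        mul_le_mul_of_nonneg_left h7 (by positivity)
      have h9 : (m + 1 : ℝ) * (2 * δ) = ε := by rw [hδ]; field_simp
      nlinarith
    obtain ⟨d, hd, hdle⟩ := exists_of_subeq α hC hD hsub
    have hdg : ∀ z, d z ≤ g' z := by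
      intro z
      refine (hdle z).trans ?_
      by_cases hz : z ∈ Z \ U
      · rw [ind_mem hD hz]
        exact Nat.one_le_iff_ne_zero.2 hz.1
      · rw [ind_notMem hD hz]; exact Nat.zero_le _
    obtain ⟨g'', hg''⟩ := exists_add_of_le hdg
    have hpt : ∀ z, d z + g'' z = g' z := fun z =>
      congrArg (fun f : C(X, ℕ) => f z) hg''
    rw [← hg'', cls_add, cls_add, (cls_eq_iff α _ _).2 hd]
    refine tle_add (tle_refl _) (ih g'' ?_ ?_ ?_)
    · intro h0
      have h1 := hpt x
      have h2 := hdle x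
      rw [ind_notMem hD (fun h => h.2 hxU)] at h2
      rw [h0] at h1
      simp at h1
      omega
    · intro z
      have := hpt z
      have := hm' z
      omega
    · intro μ hμ
      have h1 := hgap' μ hμ
      rw [← hg'', intOf_add α hμ, intOf_add α hμ, intOf_typeRel α hμ hd] at h1
      linarith

theorem au_finite [Finite X] [Nonempty X] (α : Γ →* X ≃ₜ X) (hmin : IsMinimalAction α) :
    IsAlmostUnperforated α := by
  classical
  have := Fintype.ofFinite X
  have hdisc : DiscreteTopology X := inferInstance
  have hsum : ∀ f g, TypeRel α f g → ∑ x, f x = ∑ x, g x := by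
    rintro _ _ ⟨n, h, γ, rfl, rfl⟩
    simp only [ContinuousMap.sum_apply, actC_apply]
    rw [Finset.sum_comm, Finset.sum_comm (s := Finset.univ (α := X))]
    refine Finset.sum_congr rfl fun i _ => ?_
    exact (Equiv.sum_comp (α (γ i)⁻¹).toEquiv (h i)).symm
  obtain ⟨x₀⟩ := ‹Nonempty X›
  let e : X → C(X, ℕ) := fun x => ind {x} (isClopen_discrete _)
  have he : ∀ x, cls α (e x) = cls α (e x₀) := by
    intro x
    have horb : x ∈ (Set.range fun γ : Γ => α γ x₀) := by
      rcases hmin (Set.range fun γ : Γ => α γ x₀) (isClosed_discrete _) (by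
        rintro δ _ ⟨_, ⟨γ, rfl⟩, rfl⟩
        exact ⟨δ * γ, act_mul α δ γ x₀⟩) with h | h
      · exact absurd h (Set.range_nonempty _).ne_empty
      · rw [h]; trivial
    obtain ⟨γ, hγ⟩ := horb
    simp only at hγ
    rw [← cls_actC α γ (e x₀)]
    congr 1
    ext y
    rw [actC_apply]
    show ind {x} _ y = ind {x₀} _ (α γ⁻¹ y)
    by_cases hy : y = x
    · have : α γ⁻¹ y = x₀ := by rw [hy, ← hγ, act_inv_act]
      rw [ind_mem _ (show y ∈ ({x} : Set X) from hy),
        ind_mem _ (show α γ⁻¹ y ∈ ({x₀} : Set X) from this)]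
    · have : α γ⁻¹ y ≠ x₀ := fun h => hy (by rw [← hγ, ← h, act_act_inv])
      rw [ind_notMem _ (show y ∉ ({x} : Set X) from hy),
        ind_notMem _ (show α γ⁻¹ y ∉ ({x₀} : Set X) from this)]
  have hcls : ∀ f, cls α f = (∑ x, f x) • cls α (e x₀) := by
    intro f
    have : f = ∑ x, f x • e x := by
      ext y
      rw [ContinuousMap.sum_apply, Finset.sum_eq_single y]
      · simp [e, ind]
      · intro z _ hz
        simp [e, ind, hz.symm]
      · simp
    conv_lhs => rw [this]
    rw [cls_sum, Finset.sum_smul]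
    exact Finset.sum_congr rfl fun x _ => by rw [cls_nsmul, he]
  intro a b n hab
  obtain ⟨f, rfl⟩ := cls_surj α a
  obtain ⟨g, rfl⟩ := cls_surj α b
  obtain ⟨c, hc⟩ := hab
  obtain ⟨c, rfl⟩ := cls_surj α c
  rw [← cls_nsmul, ← cls_nsmul, ← cls_add, cls_eq_iff] at hc
  have h1 := hsum _ _ hc
  simp only [ContinuousMap.add_apply, ContinuousMap.smul_apply, smul_eq_mul,
    Finset.sum_add_distrib, ← Finset.mul_sum] at h1
  rw [hcls f, hcls g]
  apply tle_nsmul_right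
  by_contra hcon
  push Not at hcon
  have h2 := Nat.mul_le_mul_left n hcon.le
  rw [add_mul, one_mul] at h1
  omega

end Greedy

/-- Let `α` be a minimal action of a countable group `Γ` by homeomorphisms
on a nonempty compact Hausdorff `0`-dimensional space `X`. Then `α` has dynamical comparison
iff `T(α)` is almost unperforated. -/
theorem stmt5 {Γ : Type*} [Group Γ] [Countable Γ]
    {X : Type*} [TopologicalSpace X] [CompactSpace X] [T2Space X]
    [TotallyDisconnectedSpace X] [Nonempty X]
    (α : Γ →* (X ≃ₜ X)) (hmin : IsMinimalAction α) :
    DynComparison α ↔ IsAlmostUnperforated α := by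
  constructor
  · intro h
    cases finite_or_infinite X with
    | inl hf => exact au_finite α hmin
    | inr hi => exact au_of_dyn_infinite α hmin h
  · exact dyn_of_au α hmin
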